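/- If A is a bijective skew PBW extension over R, where A and R are algebras over a commutative ring k, then the enveloping algebra A^e = A ⊗_k A^{op} is a bijective skew PBW extension over the enveloping algebra R^e = R ⊗_k R^{op}, with generators x_1⊗1,…,x_n⊗1, 1⊗x_n,…,1⊗x_1. -/

import Mathlib

open scoped TensorProduct
open MulOpposite

noncomputable section

/-- The standard monomial `x₁^{α₁} ⋯ xₙ^{αₙ}` (ordered product). -/
def spbwMon {A : Type*} [Ring A] {n : ℕ} (x : Fin n → A) (α : Fin n → ℕ) : A :=
  (List.ofFn fun i => x i ^ α i).prod

/-- The set `R + R x₁ + ⋯ + R xₙ` inside `A`. -/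
def spbwSpan {R A : Type*} [Ring R] [Ring A] {n : ℕ} (ι : R →+* A) (x : Fin n → A) :
    Set A :=
  {a : A | ∃ (r₀ : R) (c : Fin n → R), a = ι r₀ + ∑ l, ι (c l) * x l}

/-- `A` is a skew PBW extension over `R` (embedded in `A` via `ι`) with
generators `x₁, …, xₙ`. -/
structure IsSkewPBWExtension {R A : Type*} [Ring R] [Ring A] {n : ℕ}
    (ι : R →+* A) (x : Fin n → A) : Prop where
  /-- (i) `R ⊆ A`. -/
  inj : Function.Injective ι
  /-- (ii) `A` is a free left `R`-module with basis the standard monomials. -/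
  repr_unique : ∀ f : A, ∃! c : (Fin n → ℕ) →₀ R,
    f = c.sum fun α r => ι r * spbwMon x α
  /-- (iii) `xᵢ r − c_{i,r} xᵢ ∈ R`. -/
  mul_coeff : ∀ (i : Fin n) (r : R), r ≠ 0 → ∃ c : R, c ≠ 0 ∧
    x i * ι r - ι c * x i ∈ Set.range ι
  /-- (iv) `xⱼ xᵢ − c_{i,j} xᵢ xⱼ ∈ R + R x₁ + ⋯ + R xₙ`. -/
  mul_gen : ∀ i j : Fin n, ∃ c : R, c ≠ 0 ∧
    x j * x i - ι c * (x i * x j) ∈ spbwSpan ι x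

/-- `δ` is a `σ`-derivation: additive and `δ(rs) = σ(r)δ(s) + δ(r)s`. -/
def IsSigmaDerivation {R : Type*} [Ring R] (σ : R → R) (δ : R → R) : Prop :=
  (∀ r s : R, δ (r + s) = δ r + δ s) ∧ ∀ r s : R, δ (r * s) = σ r * δ s + δ r * s

/-- `A` is a *bijective* skew PBW extension over `R` via `ι` with generators
`x`: a skew PBW extension together with (bijective) automorphisms `σᵢ`,
`σᵢ`-derivations `δᵢ` satisfying `xᵢ r = σᵢ(r) xᵢ + δᵢ(r)`, and constants
`c_{i,j}` satisfying condition (iv) which are invertible for `i < j`. -/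
def IsBijectiveSkewPBWExtension {R A : Type*} [Ring R] [Ring A] {n : ℕ}
    (ι : R →+* A) (x : Fin n → A) : Prop :=
  IsSkewPBWExtension ι x ∧
  ∃ (σ : Fin n → R ≃+* R) (δ : Fin n → R → R) (c : Fin n → Fin n → R),
    (∀ i, IsSigmaDerivation (σ i) (δ i)) ∧
    (∀ (i : Fin n) (r : R), x i * ι r = ι (σ i r) * x i + ι (δ i r)) ∧
    (∀ i j : Fin n, x j * x i - ι (c i j) * (x i * x j) ∈ spbwSpan ι x) ∧
    (∀ i j : Fin n, i < j → IsUnit (c i j))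

section Monomials

lemma spbwMon_zero {A : Type*} [Ring A] {n : ℕ} (x : Fin n → A) : spbwMon x 0 = 1 := by
  simp [spbwMon]

lemma spbwMon_succ {A : Type*} [Ring A] {n : ℕ} (x : Fin (n + 1) → A) (α : Fin (n + 1) → ℕ) :
    spbwMon x α = x 0 ^ α 0 * spbwMon (Fin.tail x) (Fin.tail α) := by
  simp [spbwMon, List.ofFn_succ, Fin.tail]

lemma spbwMon_cons {A : Type*} [Ring A] {n : ℕ} (x : Fin (n + 1) → A) (a : ℕ) (β : Fin n → ℕ) :
    spbwMon x (Fin.cons a β) = x 0 ^ a * spbwMon (Fin.tail x) β := by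
  simp [spbwMon_succ]

lemma spbwMon_single {A : Type*} [Ring A] {n : ℕ} (x : Fin n → A) (i : Fin n) :
    spbwMon x (Pi.single i 1) = x i := by
  induction n with
  | zero => exact i.elim0
  | succ n ih =>
    rw [spbwMon_succ]
    refine Fin.cases ?_ (fun j => ?_) i
    · have : Fin.tail (Pi.single 0 1 : Fin (n + 1) → ℕ) = 0 := by
        ext j; simp [Fin.tail]
      simp [this, spbwMon_zero]
    · have : Fin.tail (Pi.single j.succ 1 : Fin (n + 1) → ℕ) = Pi.single j 1 := by
        ext l; simp [Fin.tail, Pi.single_apply]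
      rw [this, ih, Pi.single_eq_of_ne (Fin.succ_ne_zero j).symm]
      simp [Fin.tail]

lemma spbwMon_append {A : Type*} [Ring A] {n m : ℕ} (u : Fin n → A) (v : Fin m → A)
    (α : Fin n → ℕ) (β : Fin m → ℕ) :
    spbwMon (Fin.append u v) (Fin.append α β) = spbwMon u α * spbwMon v β := by
  have h : (fun i => Fin.append u v i ^ Fin.append α β i) =
      Fin.append (fun i => u i ^ α i) (fun i => v i ^ β i) := by
    ext i
    refine Fin.addCases (fun j => ?_) (fun j => ?_) i <;> simp
  simp [spbwMon, h, List.ofFn_fin_append]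

lemma map_spbwMon {A B : Type*} [Ring A] [Ring B] (f : A →+* B) {n : ℕ} (x : Fin n → A)
    (α : Fin n → ℕ) : f (spbwMon x α) = spbwMon (fun i => f (x i)) α := by
  simp [spbwMon, map_list_prod, List.map_ofFn, Function.comp_def]

lemma spbwMon_op_rev {A : Type*} [Ring A] {n : ℕ} (x : Fin n → A) (α : Fin n → ℕ) :
    spbwMon (fun i => op (x i.rev)) α = op (spbwMon x fun i => α i.rev) := by
  rw [spbwMon, spbwMon, op_list_prod]
  congr 1
  apply List.ext_getElem
  · simp
  · intro i h₁ h₂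
    simp only [List.length_ofFn] at h₁
    have e : (⟨i, h₁⟩ : Fin n).rev = ⟨n - 1 - i, by omega⟩ := by
      ext; simp only [Fin.val_rev]; omega
    simp [← e]

end Monomials

section Span

variable {R A : Type*} [Ring R] [Ring A] {n : ℕ} {ι : R →+* A} {x : Fin n → A}

lemma spbwSpan_add {a b : A} (ha : a ∈ spbwSpan ι x) (hb : b ∈ spbwSpan ι x) :
    a + b ∈ spbwSpan ι x := by
  obtain ⟨r, c, rfl⟩ := ha
  obtain ⟨s, d, rfl⟩ := hb
  refine ⟨r + s, c + d, ?_⟩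
  simp only [map_add, Pi.add_apply, add_mul, Finset.sum_add_distrib]
  abel

lemma spbwSpan_left_mul (s : R) {a : A} (ha : a ∈ spbwSpan ι x) : ι s * a ∈ spbwSpan ι x := by
  obtain ⟨r, c, rfl⟩ := ha
  exact ⟨s * r, fun l => s * c l, by simp [mul_add, Finset.mul_sum, mul_assoc]⟩

lemma spbwSpan_neg {a : A} (ha : a ∈ spbwSpan ι x) : -a ∈ spbwSpan ι x := by
  simpa using spbwSpan_left_mul (-1) ha

lemma spbwSpan_coeff (r : R) : ι r ∈ spbwSpan ι x := ⟨r, 0, by simp⟩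

lemma spbwSpan_gen (r : R) (i : Fin n) : ι r * x i ∈ spbwSpan ι x := by
  classical
  refine ⟨0, Pi.single i r, ?_⟩
  rw [Finset.sum_eq_single i] <;> simp +contextual

lemma spbwSpan_zero : (0 : A) ∈ spbwSpan ι x := by
  simpa using spbwSpan_coeff (ι := ι) (x := x) 0

lemma spbwSpan_sum {κ : Type*} (s : Finset κ) (f : κ → A) (hf : ∀ l ∈ s, f l ∈ spbwSpan ι x) :
    ∑ l ∈ s, f l ∈ spbwSpan ι x :=
  Finset.sum_induction f (· ∈ spbwSpan ι x) (fun _ _ => spbwSpan_add) spbwSpan_zero hf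

end Span

/-- The additive map `c ↦ ∑ ι (c α) * m α`. -/
def leftCombination {R A I : Type*} [Ring R] [Ring A] (ι : R →+* A) (m : I → A) :
    (I →₀ R) →+ A :=
  Finsupp.liftAddHom fun α => (AddMonoidHom.mulRight (m α)).comp ι.toAddMonoidHom

/-- The additive map `c ↦ ∑ m α * ι (c α)`. -/
def rightCombination {R A I : Type*} [Ring R] [Ring A] (ι : R →+* A) (m : I → A) :
    (I →₀ R) →+ A :=
  Finsupp.liftAddHom fun α => (AddMonoidHom.mulLeft (m α)).comp ι.toAddMonoidHom

section Combination

variable {R A I : Type*} [Ring R] [Ring A] (ι : R →+* A) (m : I → A)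

lemma leftCombination_apply (c : I →₀ R) :
    leftCombination ι m c = c.sum fun α r => ι r * m α := rfl

lemma rightCombination_apply (c : I →₀ R) :
    rightCombination ι m c = c.sum fun α r => m α * ι r := rfl

@[simp] lemma leftCombination_single (α : I) (r : R) :
    leftCombination ι m (Finsupp.single α r) = ι r * m α := by
  simp [leftCombination_apply]

@[simp] lemma rightCombination_single (α : I) (r : R) :
    rightCombination ι m (Finsupp.single α r) = m α * ι r := by
  simp [rightCombination_apply]

lemma leftCombination_bijective_iff :
    Function.Bijective (leftCombination ι m) ↔
      ∀ f : A, ∃! c : I →₀ R, f = c.sum fun α r => ι r * m α := by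
  rw [Function.bijective_iff_existsUnique]
  simp only [leftCombination_apply, eq_comm]

end Combination

/-- The additive subgroup generated by the `ι s * m β` with `β < α`. -/
def lowerTerms {R A I : Type*} [Ring R] [Ring A] [Preorder I] (ι : R →+* A) (m : I → A) (α : I) :
    AddSubgroup A :=
  AddSubgroup.closure {a | ∃ (s : R) (β : I), β < α ∧ a = ι s * m β}

lemma mem_lowerTerms {R A I : Type*} [Ring R] [Ring A] [Preorder I] (ι : R →+* A) (m : I → A)
    {α β : I} (s : R) (h : β < α) : ι s * m β ∈ lowerTerms ι m α :=
  AddSubgroup.subset_closure ⟨s, β, h, rfl⟩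

lemma map_mem_of_mem_lowerTerms {R A I : Type*} [Ring R] [Ring A] [Preorder I] {ι : R →+* A}
    {m : I → A} {α : I} {G : Type*} [AddGroup G] (f : A →+ G) (H : AddSubgroup G)
    (h : ∀ (s : R) (β : I), β < α → f (ι s * m β) ∈ H) {a : A} (ha : a ∈ lowerTerms ι m α) :
    f a ∈ H := by
  have : lowerTerms ι m α ≤ H.comap f := by
    rw [lowerTerms, AddSubgroup.closure_le]
    rintro _ ⟨s, β, hβ, rfl⟩
    exact h s β hβ
  exact this ha

/-- A left basis along which coefficients move triangularly is also a right basis. -/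
lemma rightCombination_bijective {R A I : Type*} [Ring R] [Ring A] [PartialOrder I]
    [WellFoundedLT I] (ι : R →+* A) (m : I → A)
    (hL : Function.Bijective (leftCombination ι m)) (τ : I → R ≃+* R)
    (hτ : ∀ α r, m α * ι r - ι (τ α r) * m α ∈ lowerTerms ι m α) :
    Function.Bijective (rightCombination ι m) := by
  classical
  constructor
  · rw [injective_iff_map_eq_zero]
    intro c hc
    by_contra hne
    obtain ⟨α, hα, hmax⟩ := Finset.exists_maximal (Finsupp.support_nonempty_iff.mpr hne)
    let e : (I →₀ R) ≃+ A := AddEquiv.ofBijective _ hL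
    have he : ∀ β r, e.symm (ι r * m β) = Finsupp.single β r := fun β r => by
      rw [AddEquiv.symm_apply_eq]
      exact (leftCombination_single ι m β r).symm
    let f : A →+ R := (Finsupp.applyAddHom α).comp e.symm.toAddMonoidHom
    have hf : ∀ β r, f (ι r * m β) = Finsupp.single β r α := fun β r => by
      change e.symm (ι r * m β) α = _
      rw [he]
    have key : ∀ β ∈ c.support, f (m β * ι (c β)) = Finsupp.single β (τ β (c β)) α := by
      intro β hβ
      have h0 : f (m β * ι (c β) - ι (τ β (c β)) * m β) ∈ (⊥ : AddSubgroup R) := by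
        refine map_mem_of_mem_lowerTerms f ⊥ (fun s γ hγ => ?_) (hτ β (c β))
        rw [hf, AddSubgroup.mem_bot, Finsupp.single_apply, if_neg]
        rintro rfl
        exact hγ.not_ge (hmax hβ hγ.le)
      rw [AddSubgroup.mem_bot, map_sub, sub_eq_zero] at h0
      rw [h0, hf]
    have hsum : f (rightCombination ι m c) = τ α (c α) := by
      rw [rightCombination_apply, Finsupp.sum, map_sum, Finset.sum_congr rfl key,
        Finset.sum_eq_single α]
      · simp
      · intro β _ hβ
        simp [hβ]
      · intro h
        exact absurd hα h
    rw [hc, map_zero] at hsum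
    exact Finsupp.mem_support_iff.mp hα (by simpa using hsum.symm)
  · have hmem : ∀ (α : I) (r : R), ι r * m α ∈ (rightCombination ι m).range := by
      intro α
      induction α using WellFoundedLT.induction with
      | ind α ih =>
        intro r
        have h1 := map_mem_of_mem_lowerTerms (AddMonoidHom.id A) _ (fun s β hβ => ih β hβ s)
          (hτ α ((τ α).symm r))
        have h2 : m α * ι ((τ α).symm r) ∈ (rightCombination ι m).range :=
          ⟨Finsupp.single α _, rightCombination_single ι m α _⟩
        simpa using sub_mem h2 h1
    intro a
    obtain ⟨c, rfl⟩ := hL.2 a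
    change _ ∈ (rightCombination ι m).range
    exact sum_mem fun α _ => hmem α (c α)

lemma pow_mul_coeff {R A : Type*} [Ring R] [Ring A] (ι : R →+* A) (x : A) (σ : R ≃+* R)
    (δ : R → R) (h : ∀ r, x * ι r = ι (σ r) * x + ι (δ r)) (a : ℕ) :
    ∃ τ : R ≃+* R, ∀ r, x ^ a * ι r - ι (τ r) * x ^ a ∈ lowerTerms ι (x ^ ·) a := by
  induction a with
  | zero => exact ⟨RingEquiv.refl R, fun r => by simp [zero_mem]⟩
  | succ a ih =>
    obtain ⟨τ, hτ⟩ := ih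
    refine ⟨τ.trans σ, fun r => ?_⟩
    have h1 : x * (x ^ a * ι r - ι (τ r) * x ^ a) ∈ lowerTerms ι (x ^ ·) (a + 1) := by
      refine map_mem_of_mem_lowerTerms (AddMonoidHom.mulLeft x) _ (fun s b hb => ?_) (hτ r)
      have e : x * (ι s * x ^ b) = ι (σ s) * x ^ (b + 1) + ι (δ s) * x ^ b := by
        rw [← mul_assoc, h, pow_succ']; noncomm_ring
      change x * (ι s * x ^ b) ∈ _
      rw [e]
      exact add_mem (mem_lowerTerms ι (x ^ ·) _ (by omega))
        (mem_lowerTerms ι (x ^ ·) _ (by omega))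
    have h2 : ι (δ (τ r)) * x ^ a ∈ lowerTerms ι (x ^ ·) (a + 1) :=
      mem_lowerTerms ι (x ^ ·) _ (by omega)
    have e : x ^ (a + 1) * ι r - ι (τ.trans σ r) * x ^ (a + 1) =
        x * (x ^ a * ι r - ι (τ r) * x ^ a) + ι (δ (τ r)) * x ^ a := by
      have e1 : x * (ι (τ r) * x ^ a) = ι (σ (τ r)) * (x * x ^ a) + ι (δ (τ r)) * x ^ a := by
        rw [← mul_assoc, h, add_mul, mul_assoc]
      rw [mul_sub, e1, pow_succ', mul_assoc, RingEquiv.trans_apply]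
      abel
    rw [e]
    exact add_mem h1 h2

lemma spbwMon_mul_coeff {R A : Type*} [Ring R] [Ring A] (ι : R →+* A) {n : ℕ} (x : Fin n → A)
    (h : ∀ i, ∃ (σ : R ≃+* R) (δ : R → R), ∀ r, x i * ι r = ι (σ r) * x i + ι (δ r))
    (α : Fin n → ℕ) :
    ∃ τ : R ≃+* R, ∀ r,
      spbwMon x α * ι r - ι (τ r) * spbwMon x α ∈ lowerTerms ι (spbwMon x) α := by
  induction n with
  | zero => exact ⟨RingEquiv.refl R, fun r => by simp [spbwMon, zero_mem]⟩
  | succ n ih =>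
    obtain ⟨τ, hτ⟩ := ih (Fin.tail x) (fun i => h i.succ) (Fin.tail α)
    obtain ⟨σ₀, δ₀, h₀⟩ := h 0
    obtain ⟨ρ, hρ⟩ := pow_mul_coeff ι (x 0) σ₀ δ₀ h₀ (α 0)
    refine ⟨τ.trans ρ, fun r => ?_⟩
    have lt_of_head : ∀ b < α 0, (Fin.cons b (Fin.tail α) : Fin (n + 1) → ℕ) < α := by
      intro b hb
      exact Pi.lt_def.mpr ⟨Fin.cons_le.mpr ⟨hb.le, le_rfl⟩, 0, by simpa using hb⟩
    have lt_of_tail : ∀ b ≤ α 0, ∀ β < Fin.tail α, (Fin.cons b β : Fin (n + 1) → ℕ) < α := by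
      intro b hb β hβ
      obtain ⟨hle, j, hj⟩ := Pi.lt_def.mp hβ
      exact Pi.lt_def.mpr ⟨Fin.cons_le.mpr ⟨hb, hle⟩, j.succ, by simpa [Fin.tail] using hj⟩
    have h1 : x 0 ^ α 0 * (spbwMon (Fin.tail x) (Fin.tail α) * ι r -
        ι (τ r) * spbwMon (Fin.tail x) (Fin.tail α)) ∈ lowerTerms ι (spbwMon x) α := by
      refine map_mem_of_mem_lowerTerms (AddMonoidHom.mulLeft (x 0 ^ α 0)) _
        (fun s β hβ => ?_) (hτ r)
      have h3 : (x 0 ^ α 0 * ι s - ι (ρ s) * x 0 ^ α 0) * spbwMon (Fin.tail x) β ∈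
          lowerTerms ι (spbwMon x) α := by
        refine map_mem_of_mem_lowerTerms (AddMonoidHom.mulRight (spbwMon (Fin.tail x) β)) _
          (fun s b hb => ?_) (hρ s)
        have := mem_lowerTerms ι (spbwMon x) s (lt_of_tail b hb.le β hβ)
        simpa [spbwMon_cons, mul_assoc] using this
      have h4 := mem_lowerTerms ι (spbwMon x) (ρ s) (lt_of_tail (α 0) le_rfl β hβ)
      rw [spbwMon_cons] at h4
      convert add_mem h3 h4 using 1
      simp [sub_mul, mul_assoc]
    have h2 : (x 0 ^ α 0 * ι (τ r) - ι (ρ (τ r)) * x 0 ^ α 0) *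
        spbwMon (Fin.tail x) (Fin.tail α) ∈ lowerTerms ι (spbwMon x) α := by
      refine map_mem_of_mem_lowerTerms
        (AddMonoidHom.mulRight (spbwMon (Fin.tail x) (Fin.tail α))) _
        (fun s b hb => ?_) (hρ (τ r))
      have := mem_lowerTerms ι (spbwMon x) s (lt_of_head b hb)
      simpa [spbwMon_cons, mul_assoc] using this
    convert add_mem h1 h2 using 1
    rw [spbwMon_succ, RingEquiv.trans_apply]
    noncomm_ring

lemma coeff_eq_of_leftCombination_injective {R A : Type*} [Ring R] [Ring A] {n : ℕ}
    {ι : R →+* A} {x : Fin n → A}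
    (hL : Function.Injective (leftCombination ι (spbwMon x))) (i : Fin n) {a b a' b' : R}
    (h : ι a * x i + ι b = ι a' * x i + ι b') : a = a' ∧ b = b' := by
  have key : Finsupp.single (Pi.single i 1) a + Finsupp.single (0 : Fin n → ℕ) b =
      Finsupp.single (Pi.single i 1) a' + Finsupp.single 0 b' := by
    apply hL
    simpa [spbwMon_single, spbwMon_zero] using h
  have hne : (Pi.single i 1 : Fin n → ℕ) ≠ 0 := by simp
  exact ⟨by simpa [Finsupp.single_apply, hne, hne.symm] using DFunLike.congr_fun key (Pi.single i 1),
    by simpa [Finsupp.single_apply, hne, hne.symm] using DFunLike.congr_fun key 0⟩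

lemma isBijectiveSkewPBWExtension_of {R A : Type*} [Ring R] [Ring A] {n : ℕ}
    {ι : R →+* A} {x : Fin n → A} (hR : Fin n → Nontrivial R)
    (hL : Function.Bijective (leftCombination ι (spbwMon x)))
    (hσ : ∀ i, ∃ (σ : R ≃+* R) (δ : R → R), ∀ r, x i * ι r = ι (σ r) * x i + ι (δ r))
    (hc : ∀ i j, ∃ c : R, IsUnit c ∧ x j * x i - ι c * (x i * x j) ∈ spbwSpan ι x) :
    IsBijectiveSkewPBWExtension ι x := by
  choose σ δ hσδ using hσ
  choose c hcu hcs using hc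
  refine ⟨⟨?_, (leftCombination_bijective_iff _ _).mp hL, ?_, ?_⟩,
    σ, δ, c, ?_, hσδ, hcs, fun i j _ => hcu i j⟩
  · intro r s hrs
    exact Finsupp.single_injective (0 : Fin n → ℕ) (hL.1 (by simp [hrs]))
  · intro i r hr
    refine ⟨σ i r, by simpa using hr, δ i r, ?_⟩
    rw [hσδ]
    abel
  · intro i j
    have := hR i
    exact ⟨c i j, (hcu i j).ne_zero, hcs i j⟩
  · intro i
    constructor
    · intro r s
      refine (coeff_eq_of_leftCombination_injective hL.1 i (a := σ i (r + s))
        (a' := σ i (r + s)) ?_).2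
      rw [← hσδ, map_add, mul_add, hσδ, hσδ, map_add, map_add, map_add]
      noncomm_ring
    · intro r s
      refine (coeff_eq_of_leftCombination_injective hL.1 i (a := σ i (r * s))
        (a' := σ i (r * s)) ?_).2
      rw [← hσδ, map_mul, ← mul_assoc, hσδ, add_mul, mul_assoc, hσδ, map_mul, map_mul, map_add,
        map_mul, map_mul]
      noncomm_ring

namespace IsBijectiveSkewPBWExtension

lemma leftCombination_bijective {R A : Type*} [Ring R] [Ring A] {n : ℕ}
    {ι : R →+* A} {x : Fin n → A} (h : IsBijectiveSkewPBWExtension ι x) :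
    Function.Bijective (leftCombination ι (spbwMon x)) :=
  (leftCombination_bijective_iff _ _).mpr h.1.repr_unique

lemma nontrivial {R A : Type*} [Ring R] [Ring A] {n : ℕ}
    {ι : R →+* A} {x : Fin n → A} (h : IsBijectiveSkewPBWExtension ι x) (i : Fin n) :
    Nontrivial R := by
  obtain ⟨c, hc, -⟩ := h.1.mul_gen i i
  exact nontrivial_of_ne c 0 hc

lemma exists_equiv {R A : Type*} [Ring R] [Ring A] {n : ℕ}
    {ι : R →+* A} {x : Fin n → A} (h : IsBijectiveSkewPBWExtension ι x) (i : Fin n) :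
    ∃ (σ : R ≃+* R) (δ : R → R), ∀ r, x i * ι r = ι (σ r) * x i + ι (δ r) := by
  obtain ⟨-, σ, δ, -, -, hσδ, -⟩ := h
  exact ⟨σ i, δ i, hσδ i⟩

/-- The structure constants can be chosen invertible for all pairs of indices. -/
lemma exists_isUnit {R A : Type*} [Ring R] [Ring A] {n : ℕ}
    {ι : R →+* A} {x : Fin n → A} (h : IsBijectiveSkewPBWExtension ι x) (i j : Fin n) :
    ∃ c : R, IsUnit c ∧ x j * x i - ι c * (x i * x j) ∈ spbwSpan ι x := by
  obtain ⟨-, -, -, c, -, -, hs, hu⟩ := h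
  rcases lt_trichotomy i j with hij | rfl | hij
  · exact ⟨c i j, hu i j hij, hs i j⟩
  · exact ⟨1, isUnit_one, by simpa using spbwSpan_zero⟩
  · obtain ⟨u, hu⟩ := hu j i hij
    refine ⟨((u⁻¹ : Rˣ) : R), Units.isUnit _, ?_⟩
    have := spbwSpan_neg (spbwSpan_left_mul ((u⁻¹ : Rˣ) : R) (hs j i))
    rw [← hu, mul_sub, ← mul_assoc, ← mul_assoc, ← map_mul] at this
    simpa [mul_assoc] using this

lemma exists_algEquiv {k R A : Type*} [CommRing k] [Ring R] [Algebra k R] [Ring A] [Algebra k A]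
    {n : ℕ} {ι : R →ₐ[k] A} {x : Fin n → A}
    (h : IsBijectiveSkewPBWExtension ι.toRingHom x) (i : Fin n) :
    ∃ (σ : R ≃ₐ[k] R) (δ : R →ₗ[k] R), ∀ r, x i * ι r = ι (σ r) * x i + ι (δ r) := by
  obtain ⟨σ, δ, hσδ⟩ := h.exists_equiv i
  have hL := h.leftCombination_bijective.1
  have hσδ' : ∀ r, x i * ι r = ι (σ r) * x i + ι (δ r) := hσδ
  refine ⟨AlgEquiv.ofRingEquiv (f := σ) fun r => ?_, ⟨⟨δ, fun r s => ?_⟩, fun r s => ?_⟩, hσδ⟩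
  · refine (coeff_eq_of_leftCombination_injective hL i (b := δ (algebraMap k R r)) (b' := 0) ?_).1
    rw [← hσδ]
    simp [Algebra.commutes]
  · refine (coeff_eq_of_leftCombination_injective hL i (a := σ (r + s)) (a' := σ (r + s)) ?_).2
    rw [← hσδ, map_add, mul_add, hσδ, hσδ, map_add, map_add, map_add]
    noncomm_ring
  · refine (coeff_eq_of_leftCombination_injective hL i (a := σ (r • s)) (a' := r • σ s) ?_).2
    rw [← hσδ]
    simp [hσδ']

/-- The opposite ring, with the generators in reverse order, is again a bijective skew PBW
extension. -/
theorem opposite {R A : Type*} [Ring R] [Ring A] {n : ℕ}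
    {ι : R →+* A} {x : Fin n → A} (h : IsBijectiveSkewPBWExtension ι x) :
    IsBijectiveSkewPBWExtension (RingHom.op ι) (fun i => op (x i.rev)) := by
  have swap : ∀ i, ∃ (σ : R ≃+* R) (δ : R → R), ∀ r, ι r * x i = x i * ι (σ r) + ι (δ r) := by
    intro i
    obtain ⟨σ, δ, hσδ⟩ := h.exists_equiv i
    exact ⟨σ.symm, fun r => -δ (σ.symm r), fun r => by simp [hσδ]⟩
  have hspan : ∀ a ∈ spbwSpan ι x,
      op a ∈ spbwSpan (RingHom.op ι) (fun i => op (x i.rev)) := by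
    rintro _ ⟨r, c, rfl⟩
    rw [op_add, Finset.op_sum]
    refine spbwSpan_add (spbwSpan_coeff (ι := RingHom.op ι) (op r))
      (spbwSpan_sum _ _ fun l _ => ?_)
    obtain ⟨σ, δ, hσδ⟩ := swap l
    rw [hσδ, op_add]
    refine spbwSpan_add ?_ (spbwSpan_coeff (ι := RingHom.op ι) (op _))
    simpa using spbwSpan_gen (ι := RingHom.op ι) (x := fun i => op (x i.rev))
      (op (σ (c l))) l.rev
  refine isBijectiveSkewPBWExtension_of (fun i => ?_) ?_ (fun i => ?_) (fun i j => ?_)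
  · have := h.nontrivial i
    infer_instance
  · choose τ hτ using spbwMon_mul_coeff ι x h.exists_equiv
    have hR := rightCombination_bijective ι (spbwMon x) h.leftCombination_bijective τ hτ
    let e : ((Fin n → ℕ) →₀ Rᵐᵒᵖ) ≃+ ((Fin n → ℕ) →₀ R) :=
      (Finsupp.mapRange.addEquiv opAddEquiv.symm).trans
        (Finsupp.domCongr (Equiv.arrowCongr Fin.revPerm (Equiv.refl ℕ)))
    have key : leftCombination (RingHom.op ι) (spbwMon fun i => op (x i.rev)) =
        (opAddEquiv.toAddMonoidHom.comp (rightCombination ι (spbwMon x))).comp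
          e.toAddMonoidHom := by
      refine Finsupp.addHom_ext fun α r => ?_
      have he : e (Finsupp.single α r) = Finsupp.single (fun i => α i.rev) r.unop := by
        simp [e, Equiv.arrowCongr, Function.comp_def]
      simp [he, spbwMon_op_rev]
    rw [key]
    exact (opAddEquiv.bijective.comp hR).comp e.bijective
  · obtain ⟨σ, δ, hσδ⟩ := h.exists_equiv i.rev
    refine ⟨RingEquiv.op σ.symm, fun r => op (-δ (σ.symm r.unop)), fun r => ?_⟩
    apply unop_injective
    simp [hσδ]
  · obtain ⟨u, hu, hus⟩ := h.exists_isUnit j.rev i.rev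
    obtain ⟨σ, δ, hσδ⟩ := h.exists_equiv i.rev
    obtain ⟨ρ, ε, hρε⟩ := h.exists_equiv j.rev
    have hmove : ∀ s, x j.rev * x i.rev * ι s - ι (ρ (σ s)) * (x j.rev * x i.rev) ∈
        spbwSpan ι x := by
      intro s
      have e : x j.rev * x i.rev * ι s - ι (ρ (σ s)) * (x j.rev * x i.rev) =
          ι (ε (σ s)) * x i.rev + (ι (ρ (δ s)) * x j.rev + ι (ε (δ s))) := by
        rw [mul_assoc, hσδ, mul_add, ← mul_assoc, hρε, hρε]
        noncomm_ring
      rw [e]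
      exact spbwSpan_add (spbwSpan_gen _ _) (spbwSpan_add (spbwSpan_gen _ _) (spbwSpan_coeff _))
    refine ⟨op (σ.symm (ρ.symm u)), (((hu.map ρ.symm).map σ.symm).op), ?_⟩
    convert hspan _ (spbwSpan_add hus (spbwSpan_neg (hmove (σ.symm (ρ.symm u))))) using 1
    apply unop_injective
    simp

end IsBijectiveSkewPBWExtension

section Tensor

variable {k R S A B : Type*} [CommRing k] [Ring R] [Algebra k R] [Ring S] [Algebra k S]
  [Ring A] [Algebra k A] [Ring B] [Algebra k B]

/-- A left basis over a subalgebra, as a linear equivalence over the ground ring. -/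
def leftCombinationEquiv {I : Type*} (ι : R →ₐ[k] A) (m : I → A)
    (h : Function.Bijective (leftCombination ι.toRingHom m)) : (I →₀ R) ≃ₗ[k] A :=
  LinearEquiv.ofBijective
    (Finsupp.lsum k fun α => (LinearMap.mulRight k (m α)).comp ι.toLinearMap) h

@[simp] lemma leftCombinationEquiv_single {I : Type*} (ι : R →ₐ[k] A) (m : I → A)
    (h : Function.Bijective (leftCombination ι.toRingHom m)) (α : I) (r : R) :
    leftCombinationEquiv ι m h (Finsupp.single α r) = ι r * m α :=
  leftCombination_single ι.toRingHom m α r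

lemma spbwMon_append_tmul {n m : ℕ} (x : Fin n → A) (y : Fin m → B) (α : Fin n → ℕ)
    (β : Fin m → ℕ) :
    spbwMon (Fin.append (fun i => x i ⊗ₜ[k] (1 : B)) (fun j => (1 : A) ⊗ₜ[k] y j))
      (Fin.append α β) = spbwMon x α ⊗ₜ[k] spbwMon y β := by
  have h1 := map_spbwMon (Algebra.TensorProduct.includeLeft : A →ₐ[k] A ⊗[k] B).toRingHom x α
  have h2 := map_spbwMon (Algebra.TensorProduct.includeRight : B →ₐ[k] A ⊗[k] B).toRingHom y β
  simp only [AlgHom.toRingHom_eq_coe, RingHom.coe_coe, Algebra.TensorProduct.includeLeft_apply,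
    Algebra.TensorProduct.includeRight_apply] at h1 h2
  rw [spbwMon_append, ← h1, ← h2]
  simp

lemma leftCombination_tmul_bijective {n m : ℕ} (ι : R →ₐ[k] A) (κ : S →ₐ[k] B) (x : Fin n → A)
    (y : Fin m → B) (hx : Function.Bijective (leftCombination ι.toRingHom (spbwMon x)))
    (hy : Function.Bijective (leftCombination κ.toRingHom (spbwMon y))) :
    Function.Bijective (leftCombination (Algebra.TensorProduct.map ι κ).toRingHom
      (spbwMon (Fin.append (fun i => x i ⊗ₜ[k] (1 : B)) (fun j => (1 : A) ⊗ₜ[k] y j)))) := by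
  let e : ((Fin (n + m) → ℕ) →₀ R ⊗[k] S) ≃ₗ[k] A ⊗[k] B :=
    (Finsupp.domLCongr (Fin.appendEquiv n m).symm).trans
      ((finsuppTensorFinsupp k k R S (Fin n → ℕ) (Fin m → ℕ)).symm.trans
        (TensorProduct.congr (leftCombinationEquiv ι _ hx) (leftCombinationEquiv κ _ hy)))
  have key : leftCombination (Algebra.TensorProduct.map ι κ).toRingHom
      (spbwMon (Fin.append (fun i => x i ⊗ₜ[k] (1 : B)) (fun j => (1 : A) ⊗ₜ[k] y j))) =
      e.toAddEquiv.toAddMonoidHom := by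
    refine Finsupp.addHom_ext fun γ t => ?_
    obtain ⟨⟨α, β⟩, rfl⟩ := (Fin.appendEquiv n m).surjective γ
    induction t with
    | zero => simp
    | add a b ha hb => rw [Finsupp.single_add, map_add, map_add, ha, hb]
    | tmul r s =>
      have hp : (Fin.appendEquiv n m) (α, β) = Fin.append α β := rfl
      have he : e (Finsupp.single (Fin.appendEquiv n m (α, β)) (r ⊗ₜ[k] s)) =
          (ι r * spbwMon x α) ⊗ₜ[k] (κ s * spbwMon y β) := by
        simp [e, -Fin.appendEquiv_symm_apply]
      refine Eq.trans ?_ he.symm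
      rw [leftCombination_single, hp, spbwMon_append_tmul]
      simp
  rw [key]
  exact e.bijective

lemma spbwSpan_append_left {n m : ℕ} (ι : R →ₐ[k] A) (κ : S →ₐ[k] B) (x : Fin n → A)
    (y : Fin m → B) {a : A} (ha : a ∈ spbwSpan ι.toRingHom x) :
    a ⊗ₜ[k] (1 : B) ∈ spbwSpan (Algebra.TensorProduct.map ι κ).toRingHom
      (Fin.append (fun i => x i ⊗ₜ[k] (1 : B)) (fun j => (1 : A) ⊗ₜ[k] y j)) := by
  obtain ⟨r, c, rfl⟩ := ha
  rw [TensorProduct.add_tmul, TensorProduct.sum_tmul]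
  refine spbwSpan_add ?_ (spbwSpan_sum _ _ fun l _ => ?_)
  · convert spbwSpan_coeff (r ⊗ₜ[k] (1 : S)) using 1
    simp
  · convert spbwSpan_gen (c l ⊗ₜ[k] (1 : S)) (Fin.castAdd m l) using 1
    simp

lemma spbwSpan_append_right {n m : ℕ} (ι : R →ₐ[k] A) (κ : S →ₐ[k] B) (x : Fin n → A)
    (y : Fin m → B) {b : B} (hb : b ∈ spbwSpan κ.toRingHom y) :
    (1 : A) ⊗ₜ[k] b ∈ spbwSpan (Algebra.TensorProduct.map ι κ).toRingHom
      (Fin.append (fun i => x i ⊗ₜ[k] (1 : B)) (fun j => (1 : A) ⊗ₜ[k] y j)) := by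
  obtain ⟨r, c, rfl⟩ := hb
  rw [TensorProduct.tmul_add, TensorProduct.tmul_sum]
  refine spbwSpan_add ?_ (spbwSpan_sum _ _ fun l _ => ?_)
  · convert spbwSpan_coeff ((1 : R) ⊗ₜ[k] r) using 1
    simp
  · convert spbwSpan_gen ((1 : R) ⊗ₜ[k] c l) (Fin.natAdd n l) using 1
    simp

/-- The tensor product of two bijective skew PBW extensions is a bijective skew PBW extension of
the tensor product of the coefficient rings. -/
theorem IsBijectiveSkewPBWExtension.tensorProduct {n m : ℕ} {ι : R →ₐ[k] A} {κ : S →ₐ[k] B}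
    {x : Fin n → A} {y : Fin m → B} (hRS : Fin (n + m) → Nontrivial (R ⊗[k] S))
    (hx : IsBijectiveSkewPBWExtension ι.toRingHom x)
    (hy : IsBijectiveSkewPBWExtension κ.toRingHom y) :
    IsBijectiveSkewPBWExtension (Algebra.TensorProduct.map ι κ).toRingHom
      (Fin.append (fun i => x i ⊗ₜ[k] (1 : B)) (fun j => (1 : A) ⊗ₜ[k] y j)) := by
  refine isBijectiveSkewPBWExtension_of hRS
    (leftCombination_tmul_bijective ι κ x y hx.leftCombination_bijective
      hy.leftCombination_bijective) (fun i => ?_) (fun i j => ?_)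
  · refine Fin.addCases (fun i => ?_) (fun i => ?_) i
    · obtain ⟨σ, δ, hσδ⟩ := hx.exists_algEquiv i
      refine ⟨(Algebra.TensorProduct.congr σ AlgEquiv.refl).toRingEquiv, δ.rTensor S, fun t => ?_⟩
      induction t with
      | zero => simp
      | add a b ha hb => simp only [map_add, mul_add, add_mul, ha, hb]; abel
      | tmul r s => simp [hσδ, TensorProduct.add_tmul]
    · obtain ⟨σ, δ, hσδ⟩ := hy.exists_algEquiv i
      refine ⟨(Algebra.TensorProduct.congr (AlgEquiv.refl : R ≃ₐ[k] R) σ).toRingEquiv,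
        δ.lTensor R, fun t => ?_⟩
      induction t with
      | zero => simp
      | add a b ha hb => simp only [map_add, mul_add, add_mul, ha, hb]; abel
      | tmul r s => simp [hσδ, TensorProduct.tmul_add]
  · refine Fin.addCases (fun i => ?_) (fun i => ?_) i <;>
      refine Fin.addCases (fun j => ?_) (fun j => ?_) j
    · obtain ⟨c, hc, hcs⟩ := hx.exists_isUnit i j
      refine ⟨c ⊗ₜ 1, hc.map (Algebra.TensorProduct.includeLeft : R →ₐ[k] R ⊗[k] S), ?_⟩
      convert spbwSpan_append_left ι κ x y hcs using 1
      simp [TensorProduct.sub_tmul]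
    · exact ⟨1, isUnit_one, by simpa using spbwSpan_zero⟩
    · exact ⟨1, isUnit_one, by simpa using spbwSpan_zero⟩
    · obtain ⟨c, hc, hcs⟩ := hy.exists_isUnit i j
      refine ⟨1 ⊗ₜ c, hc.map (Algebra.TensorProduct.includeRight : S →ₐ[k] R ⊗[k] S), ?_⟩
      convert spbwSpan_append_right ι κ x y hcs using 1
      simp [TensorProduct.tmul_sub]

end Tensor

lemma nontrivial_tensorProduct_op (k R : Type*) [CommRing k] [Ring R] [Algebra k R]
    [Nontrivial R] : Nontrivial (R ⊗[k] Rᵐᵒᵖ) := by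
  let f : R ⊗[k] Rᵐᵒᵖ →ₗ[k] R :=
    (LinearMap.mul' k R).comp (((opLinearEquiv k).symm : Rᵐᵒᵖ ≃ₗ[k] R).toLinearMap.lTensor R)
  refine nontrivial_of_ne 1 0 fun h => ?_
  have := congrArg f h
  simp [f, Algebra.TensorProduct.one_def] at this

/-- If `A` is a bijective skew PBW extension over `R`, where
`A` and `R` are algebras over a commutative ring `k`, then the enveloping
algebra `Aᵉ = A ⊗[k] Aᵐᵒᵖ` is a bijective skew PBW extension over the
enveloping algebra `Rᵉ = R ⊗[k] Rᵐᵒᵖ`, with generators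
`x₁⊗1, …, xₙ⊗1, 1⊗xₙ, …, 1⊗x₁`. -/
theorem enveloping_skewPBW {k R A : Type*} [CommRing k]
    [Ring R] [Algebra k R] [Ring A] [Algebra k A] {n : ℕ}
    (ι : R →ₐ[k] A) (x : Fin n → A)
    (h : IsBijectiveSkewPBWExtension ι.toRingHom x) :
    IsBijectiveSkewPBWExtension
      (Algebra.TensorProduct.map ι (AlgHom.op ι)).toRingHom
      (Fin.append (fun i => x i ⊗ₜ[k] (1 : Aᵐᵒᵖ))
        (fun i => (1 : A) ⊗ₜ[k] op (x i.rev))) := by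
  refine IsBijectiveSkewPBWExtension.tensorProduct (k := k) (κ := AlgHom.op ι)
    (fun i => ?_) h h.opposite
  have : Nontrivial R := by
    refine Fin.addCases (fun j => ?_) (fun j => ?_) i <;> exact h.nontrivial j
  exact nontrivial_tensorProduct_op k R
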